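/- There is R₀ > 0 such that for every R > R₀ there exists ρ_R ∈ W_R which minimizes the energy E over W_R, i.e. E(ρ_R) = inf_{ρ ∈ W_R} E(ρ). -/

import Mathlib

open MeasureTheory Filter Set Topology

noncomputable section

abbrev R3 : Type := EuclideanSpace ℝ (Fin 3)

def rot (θ : ℝ) (x : R3) : R3 :=
  (EuclideanSpace.equiv (Fin 3) ℝ).symm
    ![Real.cos θ * x 0 - Real.sin θ * x 1,
      Real.sin θ * x 0 + Real.cos θ * x 1,
      x 2]

def AxisymmetricFun (g : R3 → ℝ) : Prop := ∀ (θ : ℝ) (x : R3), g (rot θ x) = g x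

def AxisymmetricSet (K : Set R3) : Prop := ∀ (θ : ℝ) (x : R3), x ∈ K → rot θ x ∈ K

def rcyl (x : R3) : ℝ := Real.sqrt (x 0 ^ 2 + x 1 ^ 2)

def Bpot (K : Set R3) (ρ : R3 → ℝ) (x : R3) : ℝ := ∫ y in Kᶜ, ρ y / ‖x - y‖

def Afun (f : ℝ → ℝ) (s : ℝ) : ℝ := s * ∫ t in (0:ℝ)..s, f t / t ^ 2

def F1 (f : ℝ → ℝ) : Prop :=
  (∀ s, 0 < s → 0 ≤ f s) ∧ ContinuousOn f (Ioi 0) ∧ StrictMonoOn f (Ioi 0)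

def F2 (f : ℝ → ℝ) : Prop :=
  Tendsto (fun s => f s / s ^ ((4:ℝ)/3)) (nhdsWithin 0 (Ioi 0)) (nhds 0) ∧
  Tendsto (fun s => f s / s ^ ((4:ℝ)/3)) atTop atTop

def PhiCond (Φ : R3 → ℝ) : Prop :=
  ContDiff ℝ 1 Φ ∧ (∀ x, 0 < Φ x) ∧ AxisymmetricFun Φ ∧
  Tendsto Φ (cocompact R3) (nhds 0) ∧
  ∃ z₀ > 0, ∀ x y : R3, x 0 = y 0 → x 1 = y 1 →
    z₀ < |x 2| → |x 2| ≤ |y 2| → 0 ≤ x 2 * y 2 → Φ y ≤ Φ x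

def SolvesEP (K : Set R3) (f : ℝ → ℝ) (J Φ : R3 → ℝ) (ρ : R3 → ℝ) : Prop :=
  ∀ x ∈ Kᶜ, 0 < ρ x →
    DifferentiableAt ℝ ρ x ∧
    DifferentiableAt ℝ (fun y => f (ρ y)) x ∧
    DifferentiableAt ℝ (fun y => Bpot K ρ y + J y + Φ y) x ∧
    fderiv ℝ (fun y => f (ρ y)) x = ρ x • fderiv ℝ (fun y => Bpot K ρ y + J y + Φ y) x

def IsRotatingSolution (K : Set R3) (f : ℝ → ℝ) (J Φ : R3 → ℝ) (M : ℝ) (ρ : R3 → ℝ) : Prop :=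
  ContinuousOn ρ Kᶜ ∧ (∀ x, 0 ≤ ρ x) ∧ HasCompactSupport ρ ∧ AxisymmetricFun ρ ∧
  SolvesEP K f J Φ ρ ∧ (∫ x in Kᶜ, ρ x) = M

def Jprof (Ω : ℝ → ℝ) (x : R3) : ℝ := ∫ s in (0:ℝ)..(rcyl x), s * Ω s ^ 2

def Jconst (Ω : ℝ) (x : R3) : ℝ := (1/2) * Ω ^ 2 * rcyl x ^ 2

def OmegaCond (Ω : ℝ → ℝ) : Prop :=
  (∀ s, 0 ≤ s → 0 ≤ s * Ω s ^ 2) ∧ ContinuousOn (fun s => s * Ω s ^ 2) (Ici 0) ∧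
  IntegrableOn (fun s => s * Ω s ^ 2) (Ici 0)

/-- The admissible set `W` of axisymmetric nonnegative densities of total mass `M`
with finite internal energy. -/
def Wset (K : Set R3) (f : ℝ → ℝ) (M : ℝ) : Set (R3 → ℝ) :=
  {ρ | AxisymmetricFun ρ ∧ (∀ᵐ x ∂(volume.restrict Kᶜ), 0 ≤ ρ x) ∧
       IntegrableOn (fun x => Afun f (ρ x)) Kᶜ ∧ (∫ x in Kᶜ, ρ x) = M}

/-- The energy functional
`E(ρ) = ∫_{ℝ³∖K} (A(ρ) - ½ρBρ - ρJ - ρΦ_K)`. -/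
def Energy (K : Set R3) (f : ℝ → ℝ) (J Φ : R3 → ℝ) (ρ : R3 → ℝ) : ℝ :=
  ∫ x in Kᶜ, (Afun f (ρ x) - (1/2) * ρ x * Bpot K ρ x - ρ x * J x - ρ x * Φ x)

/-- The truncated admissible set `W_R`: members of `W` supported in the ball `S_R`
and bounded above by `R` a.e. -/
def WR (K : Set R3) (f : ℝ → ℝ) (M : ℝ) (R : ℝ) : Set (R3 → ℝ) :=
  {ρ ∈ Wset K f M | tsupport ρ ⊆ Metric.closedBall 0 R ∧
    ∀ᵐ x : R3, 0 ≤ ρ x ∧ ρ x ≤ R}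

theorem exists_weakly_convergent_subseq {H : Type*} [NormedAddCommGroup H]
    [InnerProductSpace ℝ H] [CompleteSpace H] [TopologicalSpace.SeparableSpace H]
    {C : ℝ} {u : ℕ → H} (hu : ∀ n, ‖u n‖ ≤ C) :
    ∃ v : H, ∃ k : ℕ → ℕ, StrictMono k ∧
      ∀ w, Tendsto (fun n => inner ℝ (u (k n)) w) atTop (𝓝 (inner ℝ v w)) := by
  let x : ℕ → WeakDual ℝ H := fun n =>
    StrongDual.toWeakDual (InnerProductSpace.toDual ℝ H (u n))
  have hx : ∀ n, x n ∈ WeakDual.toStrongDual ⁻¹'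
      Metric.closedBall (0 : StrongDual ℝ H) C := by
    intro n
    simpa [x] using hu n
  obtain ⟨a, -, k, hk, hlim⟩ := WeakDual.isSeqCompact_closedBall ℝ H 0 C hx
  refine ⟨(InnerProductSpace.toDual ℝ H).symm (WeakDual.toStrongDual a), k, hk, fun w => ?_⟩
  have h := ((WeakDual.eval_continuous (𝕜 := ℝ) (E := H) w).tendsto a).comp hlim
  rw [InnerProductSpace.toDual_symm_apply]
  exact h

theorem mem_of_weak_limit {H : Type*} [NormedAddCommGroup H]
    [InnerProductSpace ℝ H] [CompleteSpace H] {S : Set H} (hS : Convex ℝ S) (hcl : IsClosed S)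
    {u : ℕ → H} {v : H} (hu : ∀ᶠ n in atTop, u n ∈ S)
    (hlim : ∀ w, Tendsto (fun n => inner ℝ (u n) w) atTop (𝓝 (inner ℝ v w))) : v ∈ S := by
  by_contra hv
  obtain ⟨l, c, hl, hlv⟩ := geometric_hahn_banach_closed_point hS hcl hv
  have hrep : ∀ x, l x = inner ℝ x ((InnerProductSpace.toDual ℝ H).symm l) := by
    intro x
    rw [real_inner_comm, InnerProductSpace.toDual_symm_apply]
  have h := hlim ((InnerProductSpace.toDual ℝ H).symm l)
  simp only [← hrep] at h
  have : l v ≤ c := le_of_tendsto h (hu.mono fun n hn => (hl _ hn).le)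
  linarith

/-- A functional that is convex and lower semicontinuous up to a weakly sequentially continuous
perturbation attains its minimum on a bounded closed convex set. -/
theorem exists_min_of_convex_sub_weaklyContinuous {H : Type*} [NormedAddCommGroup H]
    [InnerProductSpace ℝ H] [CompleteSpace H] [TopologicalSpace.SeparableSpace H]
    {S : Set H} (hne : S.Nonempty) (hconv : Convex ℝ S) (hcl : IsClosed S)
    {C : ℝ} (hC : ∀ x ∈ S, ‖x‖ ≤ C) {F Q : H → ℝ}
    (hFconv : ConvexOn ℝ S F) (hFcl : ∀ c, IsClosed {x | x ∈ S ∧ F x ≤ c})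
    (hQ : ∀ (u : ℕ → H) (v : H), (∀ n, u n ∈ S) → v ∈ S →
      (∀ w, Tendsto (fun n => inner ℝ (u n) w) atTop (𝓝 (inner ℝ v w))) →
      Tendsto (fun n => Q (u n)) atTop (𝓝 (Q v)))
    {m : ℝ} (hm : ∀ x ∈ S, m ≤ F x - Q x) :
    ∃ x ∈ S, ∀ y ∈ S, F x - Q x ≤ F y - Q y := by
  have hbdd : BddBelow ((fun x => F x - Q x) '' S) := ⟨m, by rintro _ ⟨x, hx, rfl⟩; exact hm x hx⟩
  obtain ⟨t, -, ht, htS⟩ := exists_seq_tendsto_sInf (hne.image fun x => F x - Q x) hbdd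
  choose u huS hut using htS
  obtain ⟨v, k, hk, hlim⟩ := exists_weakly_convergent_subseq fun n => hC _ (huS n)
  have hv : v ∈ S := mem_of_weak_limit hconv hcl (Eventually.of_forall fun n => huS (k n)) hlim
  have hq := hQ (fun n => u (k n)) v (fun n => huS _) hv hlim
  have hF : Tendsto (fun n => F (u (k n))) atTop
      (𝓝 (sInf ((fun x => F x - Q x) '' S) + Q v)) := by
    refine ((ht.comp hk.tendsto_atTop).add hq).congr fun n => ?_
    have := hut (k n)
    simp only [Function.comp_apply]
    linarith
  refine ⟨v, hv, fun y hy => ?_⟩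
  have hle : F v ≤ sInf ((fun x => F x - Q x) '' S) + Q v := by
    refine le_of_forall_pos_le_add fun ε hε => ?_
    refine (mem_of_weak_limit (hFconv.convex_le _) (hFcl _) ?_ hlim).2
    filter_upwards [hF.eventually (gt_mem_nhds (lt_add_of_pos_right _ hε))] with n hn
    exact ⟨huS _, hn.le⟩
  have := csInf_le hbdd (mem_image_of_mem (fun x => F x - Q x) hy)
  linarith

theorem intervalIntegrable_div_sq {f : ℝ → ℝ} (hf1 : F1 f) (hf2 : F2 f) {s : ℝ} (hs : 0 ≤ s) :
    IntervalIntegrable (fun t => f t / t ^ 2) volume 0 s := by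
  obtain ⟨hf0, hfc, -⟩ := hf1
  have hcont : ContinuousOn (fun t => f t / t ^ 2) (Ioi 0) :=
    hfc.div (by fun_prop) fun t ht => pow_ne_zero _ (ne_of_gt ht)
  have hsmall : ∀ᶠ t in 𝓝[>] (0 : ℝ), f t / t ^ ((4 : ℝ) / 3) < 1 :=
    hf2.1.eventually (gt_mem_nhds zero_lt_one)
  obtain ⟨δ, hδ, hδs⟩ := mem_nhdsGT_iff_exists_Ioc_subset.1 hsmall
  have hδ0 : (0 : ℝ) < δ := hδ
  have h1 : IntervalIntegrable (fun t => f t / t ^ 2) volume 0 δ := by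
    refine (intervalIntegral.intervalIntegrable_rpow' (r := -(2 / 3 : ℝ))
      (by norm_num)).mono_fun ?_ ?_
    · rw [uIoc_of_le hδ0.le]
      exact (hcont.mono Ioc_subset_Ioi_self).aestronglyMeasurable measurableSet_Ioc
    · rw [uIoc_of_le hδ0.le]
      refine (ae_restrict_mem measurableSet_Ioc).mono fun t ht => ?_
      have ht0 : 0 < t := ht.1
      have hlt : f t / t ^ ((4 : ℝ) / 3) < 1 := hδs ht
      rw [div_lt_one (by positivity)] at hlt
      change ‖f t / t ^ 2‖ ≤ ‖t ^ (-(2 / 3 : ℝ))‖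
      rw [Real.norm_of_nonneg (div_nonneg (hf0 t ht0) (by positivity)),
        Real.norm_of_nonneg (by positivity), div_le_iff₀ (by positivity),
        ← Real.rpow_natCast t 2, ← Real.rpow_add ht0]
      norm_num
      exact hlt.le
  have h2 : IntervalIntegrable (fun t => f t / t ^ 2) volume δ (max s δ) := by
    refine ContinuousOn.intervalIntegrable (hcont.mono ?_)
    rw [uIcc_of_le (le_max_right _ _)]
    exact fun t ht => hδ0.trans_le ht.1
  refine (h1.trans h2).mono_set ?_
  rw [uIcc_of_le hs, uIcc_of_le (hs.trans (le_max_left _ _))]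
  exact Icc_subset_Icc_right (le_max_left _ _)

theorem continuousOn_Afun {f : ℝ → ℝ} (hf1 : F1 f) (hf2 : F2 f) :
    ContinuousOn (Afun f) (Ici 0) := by
  intro s hs
  have hs0 : (0 : ℝ) ≤ s := hs
  have h := intervalIntegrable_div_sq hf1 hf2 (s := s + 1) (by linarith)
  have h' : IntegrableOn (fun t => f t / t ^ 2) (uIcc 0 (s + 1)) := by
    rwa [uIcc_of_le (by linarith), ← intervalIntegrable_iff_integrableOn_Icc_of_le (by linarith)]
  have hc := continuousOn_id.mul (intervalIntegral.continuousOn_primitive_interval h')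
  rw [uIcc_of_le (by linarith)] at hc
  refine (hc s ⟨hs0, by linarith⟩).mono_of_mem_nhdsWithin ?_
  exact mem_nhdsWithin.2 ⟨Iio (s + 1), isOpen_Iio, by simp, fun t ht => ⟨ht.2, le_of_lt ht.1⟩⟩

theorem hasDerivAt_Afun {f : ℝ → ℝ} (hf1 : F1 f) (hf2 : F2 f) {s : ℝ} (hs : 0 < s) :
    HasDerivAt (Afun f) ((∫ t in (0 : ℝ)..s, f t / t ^ 2) + f s / s) s := by
  have hcont : ContinuousOn (fun t => f t / t ^ 2) (Ioi 0) :=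
    hf1.2.1.div (by fun_prop) fun t ht => pow_ne_zero _ (ne_of_gt ht)
  have h := intervalIntegral.integral_hasDerivAt_right
    (intervalIntegrable_div_sq hf1 hf2 hs.le)
    (hcont.stronglyMeasurableAtFilter isOpen_Ioi s hs)
    (hcont.continuousAt (Ioi_mem_nhds hs))
  refine HasDerivAt.congr_deriv (f := Afun f) ((hasDerivAt_id s).mul h) ?_
  simp only [id, one_mul]
  field_simp

theorem convexOn_Afun {f : ℝ → ℝ} (hf1 : F1 f) (hf2 : F2 f) :
    ConvexOn ℝ (Ici 0) (Afun f) := by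
  refine MonotoneOn.convexOn_of_deriv (convex_Ici 0) (continuousOn_Afun hf1 hf2) ?_ ?_
  · rw [interior_Ici]
    exact fun s hs => (hasDerivAt_Afun hf1 hf2 hs).differentiableAt.differentiableWithinAt
  rw [interior_Ici]
  intro s hs t ht hst
  have hs0 : 0 < s := hs
  have ht0 : 0 < t := ht
  rw [(hasDerivAt_Afun hf1 hf2 hs).deriv, (hasDerivAt_Afun hf1 hf2 ht).deriv]
  have hint := intervalIntegrable_div_sq hf1 hf2 ht0.le
  have hint1 : IntervalIntegrable (fun t => f t / t ^ 2) volume s t := by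
    refine hint.mono_set ?_
    rw [uIcc_of_le hst, uIcc_of_le ht0.le]
    exact Icc_subset_Icc_left hs0.le
  rw [← intervalIntegral.integral_add_adjacent_intervals
    (intervalIntegrable_div_sq hf1 hf2 hs0.le) hint1]
  have hpow : ∫ r in s..t, f s / r ^ 2 = f s * (1 / s - 1 / t) := by
    have h0 : (0 : ℝ) ∉ uIcc s t := by
      rw [uIcc_of_le hst]; exact fun h => absurd h.1 (not_le.2 hs0)
    have := integral_zpow (a := s) (b := t) (n := -2) (Or.inr ⟨by norm_num, h0⟩)
    norm_num at this
    simp only [div_eq_mul_inv, intervalIntegral.integral_const_mul]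
    simp only [one_mul]
    rw [this]
    ring
  have hconst : IntervalIntegrable (fun r => f s / r ^ 2) volume s t := by
    refine ContinuousOn.intervalIntegrable (continuousOn_const.div (by fun_prop) ?_)
    rw [uIcc_of_le hst]
    exact fun r hr => pow_ne_zero _ (hs0.trans_le hr.1).ne'
  have hmono : ∫ r in s..t, f s / r ^ 2 ≤ ∫ r in s..t, f r / r ^ 2 := by
    refine intervalIntegral.integral_mono_on hst hconst hint1 fun r hr => ?_
    have hr0 : 0 < r := hs0.trans_le hr.1
    have := hf1.2.2.monotoneOn hs (show r ∈ Ioi 0 from hr0) hr.1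
    gcongr
  have hft : f s / t ≤ f t / t := by
    have := hf1.2.2.monotoneOn hs ht hst
    gcongr
  have hexp : f s * (1 / s - 1 / t) = f s / s - f s / t := by ring
  linarith

theorem Afun_zero (f : ℝ → ℝ) : Afun f 0 = 0 := by simp [Afun]

/-- The singular part of `‖z‖⁻²`. -/
def singularPart (z : R3) : ℝ := (Iio (1 : ℝ)).indicator (fun r => (r ^ 2)⁻¹) ‖z‖

theorem singularPart_nonneg (z : R3) : 0 ≤ singularPart z :=
  indicator_nonneg (fun r _ => by positivity) _

theorem integrable_singularPart : Integrable singularPart := by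
  refine (integrable_fun_norm_addHaar (volume : Measure R3)
    (f := (Iio (1 : ℝ)).indicator fun r => (r ^ 2)⁻¹)).2 ?_
  have h : IntegrableOn ((Iio (1 : ℝ)).indicator fun _ => (1 : ℝ)) (Ioi 0) := by
    rw [integrableOn_indicator_iff measurableSet_Iio, Iio_inter_Ioi]
    simp
  refine h.congr_fun (fun r hr => ?_) measurableSet_Ioi
  have hr0 : (r : ℝ) ≠ 0 := ne_of_gt hr
  by_cases h1 : r ∈ Iio (1 : ℝ)
  · simp [indicator_of_mem h1, finrank_euclideanSpace, hr0]
  · simp [indicator_of_notMem h1]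

theorem sq_inv_norm_le (z : R3) : (1 / ‖z‖) ^ 2 ≤ singularPart z + 1 := by
  by_cases h : ‖z‖ < 1
  · simp [singularPart, h]
  · have h1 : 1 ≤ ‖z‖ := not_lt.1 h
    have : 1 / ‖z‖ ≤ 1 := by rw [div_le_one (by linarith)]; exact h1
    have h0 : 0 ≤ 1 / ‖z‖ := by positivity
    have := singularPart_nonneg z
    nlinarith

theorem inv_norm_le (z : R3) : 1 / ‖z‖ ≤ singularPart z + 1 := by
  have h0 : 0 ≤ 1 / ‖z‖ := by positivity
  by_cases h : 1 ≤ 1 / ‖z‖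
  · exact le_trans (by nlinarith) (sq_inv_norm_le z)
  · have := singularPart_nonneg z
    linarith

section Potential

variable {D : Set R3}

theorem integrable_singularPart_sub [IsFiniteMeasure (volume.restrict D)] (x : R3) :
    Integrable (fun y => singularPart (x - y) + 1) (volume.restrict D) :=
  (integrable_singularPart.comp_sub_left x).restrict.add (integrable_const 1)

theorem integral_singularPart_sub_le [IsFiniteMeasure (volume.restrict D)] (x : R3) :
    ∫ y in D, (singularPart (x - y) + 1) ≤ (∫ z, singularPart z) + volume.real D := by
  rw [integral_add (integrable_singularPart.comp_sub_left x).restrict (integrable_const 1)]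
  have h := setIntegral_le_integral (s := D) (integrable_singularPart.comp_sub_left x)
    (Eventually.of_forall fun y => singularPart_nonneg _)
  rw [integral_sub_left_eq_self singularPart volume x] at h
  simpa using h

theorem memLp_inv_norm_sub [IsFiniteMeasure (volume.restrict D)] (x : R3) :
    MemLp (fun y => 1 / ‖x - y‖) 2 (volume.restrict D) := by
  have hm : Measurable fun y : R3 => 1 / ‖x - y‖ := by fun_prop
  rw [memLp_two_iff_integrable_sq hm.aestronglyMeasurable]
  refine (integrable_singularPart_sub x).mono' (hm.pow_const 2).aestronglyMeasurable ?_
  refine Eventually.of_forall fun y => ?_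
  rw [Real.norm_of_nonneg (by positivity)]
  exact sq_inv_norm_le _

theorem abs_potential_le [IsFiniteMeasure (volume.restrict D)] {R : ℝ} (hR : 0 ≤ R) {φ : R3 → ℝ}
    (hφ : ∀ᵐ y ∂(volume.restrict D), φ y ∈ Icc 0 R) (x : R3) :
    |∫ y in D, φ y / ‖x - y‖| ≤ R * ((∫ z, singularPart z) + volume.real D) := by
  rw [← Real.norm_eq_abs]
  refine le_trans ?_ (mul_le_mul_of_nonneg_left (integral_singularPart_sub_le x) hR)
  rw [← integral_const_mul]
  refine norm_integral_le_of_norm_le ((integrable_singularPart_sub (D := D) x).const_mul R) ?_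
  filter_upwards [hφ] with y hy
  rw [Real.norm_of_nonneg (div_nonneg hy.1 (norm_nonneg _)), div_eq_mul_one_div]
  have := inv_norm_le (x - y)
  have := hy.1
  have := hy.2
  gcongr

theorem stronglyMeasurable_potential [IsFiniteMeasure (volume.restrict D)] {φ : R3 → ℝ}
    (hφ : StronglyMeasurable φ) :
    StronglyMeasurable fun x => ∫ y in D, φ y / ‖x - y‖ := by
  refine StronglyMeasurable.integral_prod_right'
    (f := fun p : R3 × R3 => φ p.2 / ‖p.1 - p.2‖) ?_
  refine Measurable.stronglyMeasurable ?_
  have := hφ.measurable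
  fun_prop

/-- Weak convergence of uniformly bounded densities gives convergence of their
gravitational energies. -/
theorem tendsto_integral_mul_potential [IsFiniteMeasure (volume.restrict D)] {R : ℝ} (hR : 0 ≤ R)
    {u : ℕ → Lp ℝ 2 (volume.restrict D)} {v : Lp ℝ 2 (volume.restrict D)}
    (hu : ∀ n, ∀ᵐ y ∂(volume.restrict D), u n y ∈ Icc 0 R)
    (hv : ∀ᵐ y ∂(volume.restrict D), v y ∈ Icc 0 R)
    (hlim : ∀ w, Tendsto (fun n => inner ℝ (u n) w) atTop (𝓝 (inner ℝ v w))) :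
    Tendsto (fun n => ∫ x in D, u n x * ∫ y in D, u n y / ‖x - y‖) atTop
      (𝓝 (∫ x in D, v x * ∫ y in D, v y / ‖x - y‖)) := by
  set B : Lp ℝ 2 (volume.restrict D) → R3 → ℝ := fun φ x => ∫ y in D, φ y / ‖x - y‖ with hB
  set C : ℝ := R * ((∫ z, singularPart z) + volume.real D) with hC
  have hBm : ∀ φ, StronglyMeasurable (B φ) := fun φ =>
    stronglyMeasurable_potential (Lp.stronglyMeasurable φ)
  have hBu : ∀ n x, |B (u n) x| ≤ C := fun n x => abs_potential_le hR (hu n) x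
  have hBv : ∀ x, |B v x| ≤ C := fun x => abs_potential_le hR hv x
  have hpt : ∀ x, Tendsto (fun n => B (u n) x) atTop (𝓝 (B v x)) := by
    intro x
    have hrep : ∀ φ : Lp ℝ 2 (volume.restrict D),
        inner ℝ φ ((memLp_inv_norm_sub (D := D) x).toLp _) = B φ x := by
      intro φ
      rw [L2.inner_def]
      refine integral_congr_ae ?_
      filter_upwards [(memLp_inv_norm_sub (D := D) x).coeFn_toLp] with y hy
      rw [hy]
      simp [div_eq_mul_inv, mul_comm]
    simpa only [hrep] using hlim ((memLp_inv_norm_sub (D := D) x).toLp _)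
  have hBvL : MemLp (B v) 2 (volume.restrict D) :=
    MemLp.of_bound (hBm v).aestronglyMeasurable C (Eventually.of_forall hBv)
  have hmain : Tendsto (fun n => ∫ x in D, u n x * B v x) atTop (𝓝 (∫ x in D, v x * B v x)) := by
    have hrep : ∀ φ : Lp ℝ 2 (volume.restrict D),
        inner ℝ φ (hBvL.toLp _) = ∫ x in D, φ x * B v x := by
      intro φ
      rw [L2.inner_def]
      refine integral_congr_ae ?_
      filter_upwards [hBvL.coeFn_toLp] with y hy
      rw [hy]
      simp [mul_comm]
    simpa only [hrep] using hlim (hBvL.toLp _)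
  have herr : Tendsto (fun n => ∫ x in D, u n x * (B (u n) x - B v x)) atTop (𝓝 0) := by
    rw [← integral_zero R3 ℝ (μ := volume.restrict D)]
    refine tendsto_integral_of_dominated_convergence (fun _ => R * (C + C)) (fun n => ?_)
      (integrable_const _) (fun n => ?_) ?_
    · exact ((Lp.stronglyMeasurable _).mul ((hBm _).sub (hBm _))).aestronglyMeasurable
    · filter_upwards [hu n] with x hx
      rw [norm_mul, Real.norm_of_nonneg hx.1]
      exact mul_le_mul hx.2 ((norm_sub_le _ _).trans (add_le_add (hBu n x) (hBv x)))
        (norm_nonneg _) hR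
    · filter_upwards [ae_all_iff.2 hu] with x hx
      have h0 : Tendsto (fun n => R * |B (u n) x - B v x|) atTop (𝓝 0) := by
        have := ((hpt x).sub_const (B v x)).abs.const_mul R
        simpa using this
      refine squeeze_zero_norm (fun n => ?_) h0
      rw [norm_mul, Real.norm_of_nonneg (hx n).1]
      exact mul_le_mul_of_nonneg_right (hx n).2 (norm_nonneg _)
  have hint : ∀ φ ψ : Lp ℝ 2 (volume.restrict D), (∀ᵐ y ∂(volume.restrict D), φ y ∈ Icc 0 R) →
      (∀ x, |B ψ x| ≤ C) → Integrable (fun x => φ x * B ψ x) (volume.restrict D) := by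
    intro φ ψ hφ hψ
    refine Integrable.of_bound
      ((Lp.stronglyMeasurable φ).mul (hBm ψ)).aestronglyMeasurable (R * C) ?_
    filter_upwards [hφ] with x hx
    rw [norm_mul, Real.norm_of_nonneg hx.1]
    exact mul_le_mul hx.2 (hψ x) (norm_nonneg _) hR
  have hsum := herr.add hmain
  rw [zero_add] at hsum
  refine hsum.congr fun n => ?_
  rw [← integral_add]
  · exact integral_congr_ae (Eventually.of_forall fun x => by simp only; ring)
  · refine ((hint _ _ (hu n) (hBu n)).sub (hint _ _ (hu n) hBv)).congr
      (Eventually.of_forall fun x => ?_)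
    simp only [Pi.sub_apply]
    ring
  · exact hint _ _ (hu n) hBv

end Potential

/-- Densities on `D` of mass `M` that are axisymmetric and take values in `[0, R]`, with
measurable potential energy density. -/
structure IsBoundedDensity (D : Set R3) (V : R3 → ℝ) (M R : ℝ) (ρ : R3 → ℝ) : Prop where
  axisymmetric : AxisymmetricFun ρ
  mem_Icc : ∀ x, ρ x ∈ Icc 0 R
  eq_zero : ∀ x ∉ D, ρ x = 0
  aestronglyMeasurable : AEStronglyMeasurable ρ (volume.restrict D)
  aestronglyMeasurable_mul : AEStronglyMeasurable (fun x => ρ x * V x) (volume.restrict D)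
  mass : ∫ x in D, ρ x = M

/-- The classes in `L²` of the bounded densities. -/
def boundedDensityClass (D : Set R3) (V : R3 → ℝ) (M R : ℝ) : Set (Lp ℝ 2 (volume.restrict D)) :=
  {φ | ∃ ρ, IsBoundedDensity D V M R ρ ∧ φ =ᵐ[volume.restrict D] ρ}

/-- Pointwise limit of a real sequence, with value `0` where it diverges. -/
def limOrZero (s : ℕ → ℝ) : ℝ :=
  open Classical in if h : ∃ l, Tendsto s atTop (𝓝 l) then h.choose else 0

theorem limOrZero_eq {s : ℕ → ℝ} {l : ℝ} (h : Tendsto s atTop (𝓝 l)) : limOrZero s = l := by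
  have h' : ∃ l, Tendsto s atTop (𝓝 l) := ⟨l, h⟩
  rw [limOrZero, dif_pos h']
  exact tendsto_nhds_unique h'.choose_spec h

theorem limOrZero_mem_Icc {s : ℕ → ℝ} {R : ℝ} (hR : 0 ≤ R) (h : ∀ n, s n ∈ Icc 0 R) :
    limOrZero s ∈ Icc 0 R := by
  by_cases h' : ∃ l, Tendsto s atTop (𝓝 l)
  · obtain ⟨l, hl⟩ := h'
    rw [limOrZero_eq hl]
    exact isClosed_Icc.mem_of_tendsto hl (Eventually.of_forall h)
  · rw [limOrZero, dif_neg h']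
    exact ⟨le_rfl, hR⟩

section BoundedDensity

variable {D : Set R3} {V : R3 → ℝ} {M R : ℝ}

theorem mem_Icc_of_mem_boundedDensityClass {φ : Lp ℝ 2 (volume.restrict D)}
    (hφ : φ ∈ boundedDensityClass D V M R) : ∀ᵐ x ∂(volume.restrict D), φ x ∈ Icc 0 R := by
  obtain ⟨ρ, hρ, hφρ⟩ := hφ
  filter_upwards [hφρ] with x hx
  rw [hx]
  exact hρ.mem_Icc x

theorem aestronglyMeasurable_mul_of_mem_boundedDensityClass {φ : Lp ℝ 2 (volume.restrict D)}
    (hφ : φ ∈ boundedDensityClass D V M R) :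
    AEStronglyMeasurable (fun x => φ x * V x) (volume.restrict D) := by
  obtain ⟨ρ, hρ, hφρ⟩ := hφ
  refine hρ.aestronglyMeasurable_mul.congr ?_
  filter_upwards [hφρ] with x hx
  rw [hx]

theorem exists_subseq_tendsto_ae {u : ℕ → Lp ℝ 2 (volume.restrict D)}
    {v : Lp ℝ 2 (volume.restrict D)} (h : Tendsto u atTop (𝓝 v)) :
    ∃ k : ℕ → ℕ, StrictMono k ∧
      ∀ᵐ x ∂(volume.restrict D), Tendsto (fun n => u (k n) x) atTop (𝓝 (v x)) :=
  (tendstoInMeasure_of_tendsto_Lp h).exists_seq_tendsto_ae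

variable [IsFiniteMeasure (volume.restrict D)]

theorem IsBoundedDensity.integrable {ρ : R3 → ℝ} (hρ : IsBoundedDensity D V M R ρ) :
    Integrable ρ (volume.restrict D) := by
  refine Integrable.of_bound hρ.aestronglyMeasurable R (Eventually.of_forall fun x => ?_)
  rw [Real.norm_of_nonneg (hρ.mem_Icc x).1]
  exact (hρ.mem_Icc x).2

theorem convex_boundedDensityClass : Convex ℝ (boundedDensityClass D V M R) := by
  rintro φ ⟨ρ, hρ, hφρ⟩ ψ ⟨σ, hσ, hψσ⟩ a b ha hb hab
  refine ⟨fun x => a * ρ x + b * σ x, ⟨fun θ x => ?_, fun x => ?_, fun x hx => ?_, ?_, ?_, ?_⟩, ?_⟩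
  · rw [hρ.axisymmetric θ x, hσ.axisymmetric θ x]
  · exact convex_Icc 0 R (hρ.mem_Icc x) (hσ.mem_Icc x) ha hb hab
  · simp [hρ.eq_zero x hx, hσ.eq_zero x hx]
  · exact (hρ.aestronglyMeasurable.const_mul a).add (hσ.aestronglyMeasurable.const_mul b)
  · refine ((hρ.aestronglyMeasurable_mul.const_mul a).add
      (hσ.aestronglyMeasurable_mul.const_mul b)).congr (Eventually.of_forall fun x => ?_)
    simp only [Pi.add_apply]
    ring
  · rw [integral_add (hρ.integrable.const_mul a) (hσ.integrable.const_mul b),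
      integral_const_mul, integral_const_mul, hρ.mass, hσ.mass, ← add_mul, hab, one_mul]
  · filter_upwards [Lp.coeFn_add (a • φ) (b • ψ), Lp.coeFn_smul a φ, Lp.coeFn_smul b ψ,
      hφρ, hψσ] with x h1 h2 h3 h4 h5
    rw [h1, Pi.add_apply, h2, h3, Pi.smul_apply, Pi.smul_apply, h4, h5, smul_eq_mul, smul_eq_mul]

theorem isClosed_boundedDensityClass (hR : 0 ≤ R) : IsClosed (boundedDensityClass D V M R) := by
  refine IsSeqClosed.isClosed fun u v hu huv => ?_
  obtain ⟨k, -, hk⟩ := exists_subseq_tendsto_ae huv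
  choose ρ hρ huρ using hu
  have hlim : ∀ᵐ x ∂(volume.restrict D),
      Tendsto (fun n => ρ (k n) x) atTop (𝓝 (limOrZero fun n => ρ (k n) x)) ∧
        v x = limOrZero fun n => ρ (k n) x := by
    filter_upwards [hk, ae_all_iff.2 huρ] with x hx hxρ
    simp only [hxρ] at hx
    rw [limOrZero_eq hx]
    exact ⟨hx, rfl⟩
  refine ⟨fun x => limOrZero fun n => ρ (k n) x,
    ⟨fun θ x => ?_, fun x => ?_, fun x hx => ?_, ?_, ?_, ?_⟩, hlim.mono fun x hx => hx.2⟩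
  · simp only [(hρ _).axisymmetric θ x]
  · exact limOrZero_mem_Icc hR fun n => (hρ _).mem_Icc x
  · simp only [(hρ _).eq_zero x hx]
    exact limOrZero_eq tendsto_const_nhds
  · exact aestronglyMeasurable_of_tendsto_ae atTop (fun n => (hρ (k n)).aestronglyMeasurable)
      (hlim.mono fun x hx => hx.1)
  · exact aestronglyMeasurable_of_tendsto_ae atTop (fun n => (hρ (k n)).aestronglyMeasurable_mul)
      (hlim.mono fun x hx => hx.1.mul_const _)
  · refine tendsto_nhds_unique (tendsto_integral_of_dominated_convergence (fun _ => R)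
      (fun n => (hρ (k n)).aestronglyMeasurable) (integrable_const _)
      (fun n => Eventually.of_forall fun x => ?_) (hlim.mono fun x hx => hx.1)) ?_
    · rw [Real.norm_of_nonneg ((hρ (k n)).mem_Icc x).1]
      exact ((hρ (k n)).mem_Icc x).2
    · simp only [(hρ _).mass]
      exact tendsto_const_nhds

theorem norm_le_of_mem_boundedDensityClass {φ : Lp ℝ 2 (volume.restrict D)} (hR : 0 ≤ R)
    (hφ : φ ∈ boundedDensityClass D V M R) :
    ‖φ‖ ≤ (measureUnivNNReal (volume.restrict D)) ^ (ENNReal.toReal 2)⁻¹ * R := by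
  refine Lp.norm_le_of_ae_bound hR ?_
  filter_upwards [mem_Icc_of_mem_boundedDensityClass hφ] with x hx
  rw [Real.norm_of_nonneg hx.1]
  exact hx.2

end BoundedDensity

section ConvexPart

variable {D : Set R3} {V : R3 → ℝ} {M R CA CV : ℝ} {a : ℝ → ℝ}

theorem aestronglyMeasurable_comp_of_continuousOn (ha : ContinuousOn a (Ici 0))
    {μ : Measure R3} {ρ : R3 → ℝ} (hρ : AEStronglyMeasurable ρ μ) (h0 : ∀ᵐ x ∂μ, 0 ≤ ρ x) :
    AEStronglyMeasurable (fun x => a (ρ x)) μ := by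
  have hc : Continuous fun s => a (max s 0) :=
    ha.comp_continuous (by fun_prop) fun s => le_max_right s 0
  refine (hc.comp_aestronglyMeasurable hρ).congr ?_
  filter_upwards [h0] with x hx
  rw [max_eq_left hx]

theorem norm_convexPart_integrand_le (hD : MeasurableSet D)
    (hab : ∀ s ∈ Icc 0 R, |a s| ≤ CA) (hV : ∀ x ∈ D, |V x| ≤ CV)
    {φ : Lp ℝ 2 (volume.restrict D)}
    (hφ : φ ∈ boundedDensityClass D V M R) :
    ∀ᵐ x ∂(volume.restrict D), ‖a (φ x) - φ x * V x‖ ≤ CA + R * CV := by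
  filter_upwards [mem_Icc_of_mem_boundedDensityClass hφ, ae_restrict_mem hD] with x hx hxD
  refine (norm_sub_le _ _).trans (add_le_add (hab _ hx) ?_)
  rw [norm_mul, Real.norm_of_nonneg hx.1]
  exact mul_le_mul hx.2 (hV x hxD) (norm_nonneg _) (hx.1.trans hx.2)

theorem aestronglyMeasurable_convexPart_integrand (hac : ContinuousOn a (Ici 0))
    {φ : Lp ℝ 2 (volume.restrict D)}
    (hφ : φ ∈ boundedDensityClass D V M R) :
    AEStronglyMeasurable (fun x => a (φ x) - φ x * V x) (volume.restrict D) :=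
  (aestronglyMeasurable_comp_of_continuousOn hac (Lp.aestronglyMeasurable φ)
    ((mem_Icc_of_mem_boundedDensityClass hφ).mono fun _ h => h.1)).sub
    (aestronglyMeasurable_mul_of_mem_boundedDensityClass hφ)

theorem integrable_convexPart (hD : MeasurableSet D)
    [IsFiniteMeasure (volume.restrict D)] (hac : ContinuousOn a (Ici 0))
    (hab : ∀ s ∈ Icc 0 R, |a s| ≤ CA) (hV : ∀ x ∈ D, |V x| ≤ CV)
    {φ : Lp ℝ 2 (volume.restrict D)}
    (hφ : φ ∈ boundedDensityClass D V M R) :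
    Integrable (fun x => a (φ x) - φ x * V x) (volume.restrict D) :=
  Integrable.of_bound (aestronglyMeasurable_convexPart_integrand hac hφ) _
    (norm_convexPart_integrand_le hD hab hV hφ)

theorem convexOn_convexPart (hD : MeasurableSet D)
    [IsFiniteMeasure (volume.restrict D)] (hac : ContinuousOn a (Ici 0))
    (hab : ∀ s ∈ Icc 0 R, |a s| ≤ CA) (hV : ∀ x ∈ D, |V x| ≤ CV)
    (hconv : ConvexOn ℝ (Ici 0) a) :
    ConvexOn ℝ (boundedDensityClass D V M R) fun φ => ∫ x in D, (a (φ x) - φ x * V x) := by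
  refine ⟨convex_boundedDensityClass, fun φ hφ ψ hψ s t hs ht hst => ?_⟩
  have h1 := integrable_convexPart hD hac hab hV hφ
  have h2 := integrable_convexPart hD hac hab hV hψ
  simp only [smul_eq_mul]
  rw [← integral_const_mul, ← integral_const_mul,
    ← integral_add (h1.const_mul s) (h2.const_mul t)]
  refine integral_mono_ae
    (integrable_convexPart hD hac hab hV (convex_boundedDensityClass hφ hψ hs ht hst))
    ((h1.const_mul s).add (h2.const_mul t)) ?_
  filter_upwards [Lp.coeFn_add (s • φ) (t • ψ), Lp.coeFn_smul s φ, Lp.coeFn_smul t ψ,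
    mem_Icc_of_mem_boundedDensityClass hφ, mem_Icc_of_mem_boundedDensityClass hψ]
    with x e1 e2 e3 h4 h5
  have key := hconv.2 (show φ x ∈ Ici 0 from h4.1) (show ψ x ∈ Ici 0 from h5.1) hs ht hst
  simp only [e1, Pi.add_apply, e2, e3, Pi.smul_apply, smul_eq_mul] at key ⊢
  linarith

theorem isClosed_convexPart_le (hD : MeasurableSet D)
    [IsFiniteMeasure (volume.restrict D)] (hac : ContinuousOn a (Ici 0))
    (hab : ∀ s ∈ Icc 0 R, |a s| ≤ CA) (hV : ∀ x ∈ D, |V x| ≤ CV)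
    (hR : 0 ≤ R) (c : ℝ) :
    IsClosed {φ | φ ∈ boundedDensityClass D V M R ∧ ∫ x in D, (a (φ x) - φ x * V x) ≤ c} := by
  refine IsSeqClosed.isClosed fun u v hu huv => ?_
  have hv : v ∈ boundedDensityClass D V M R :=
    (isClosed_boundedDensityClass hR).mem_of_tendsto huv (Eventually.of_forall fun n => (hu n).1)
  obtain ⟨k, -, hk⟩ := exists_subseq_tendsto_ae huv
  refine ⟨hv, le_of_tendsto (tendsto_integral_of_dominated_convergence (fun _ => CA + R * CV)
    (fun n => aestronglyMeasurable_convexPart_integrand hac (hu (k n)).1) (integrable_const _)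
    (fun n => norm_convexPart_integrand_le hD hab hV (hu (k n)).1) ?_)
    (Eventually.of_forall fun n => (hu (k n)).2)⟩
  filter_upwards [hk, mem_Icc_of_mem_boundedDensityClass hv,
    ae_all_iff.2 fun n => mem_Icc_of_mem_boundedDensityClass (hu n).1] with x hx hvx hux
  refine Tendsto.sub ?_ (hx.mul_const _)
  exact ((hac _ hvx.1).tendsto).comp
    (tendsto_nhdsWithin_iff.2 ⟨hx, Eventually.of_forall fun n => (hux _).1⟩)

theorem exists_min_energy_boundedDensityClass (hD : MeasurableSet D)
    [IsFiniteMeasure (volume.restrict D)] (hac : ContinuousOn a (Ici 0))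
    (hab : ∀ s ∈ Icc 0 R, |a s| ≤ CA) (hV : ∀ x ∈ D, |V x| ≤ CV)
    (hconv : ConvexOn ℝ (Ici 0) a) (hR : 0 ≤ R)
    (hne : (boundedDensityClass D V M R).Nonempty) :
    ∃ φ ∈ boundedDensityClass D V M R, ∀ ψ ∈ boundedDensityClass D V M R,
      (∫ x in D, (a (φ x) - φ x * V x)) -
          1 / 2 * (∫ x in D, φ x * ∫ y in D, φ y / ‖x - y‖) ≤
        (∫ x in D, (a (ψ x) - ψ x * V x)) -
          1 / 2 * (∫ x in D, ψ x * ∫ y in D, ψ y / ‖x - y‖) := by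
  have : Fact ((2 : ENNReal) ≠ ⊤) := ⟨by simp⟩
  set C : ℝ := R * ((∫ z, singularPart z) + volume.real D)
  refine exists_min_of_convex_sub_weaklyContinuous
    (F := fun φ : Lp ℝ 2 (volume.restrict D) => ∫ x in D, (a (φ x) - φ x * V x))
    (Q := fun φ => 1 / 2 * (∫ x in D, φ x * ∫ y in D, φ y / ‖x - y‖))
    (m := -((CA + R * CV) * (volume.restrict D).real univ) -
      1 / 2 * (R * C * (volume.restrict D).real univ))
    hne convex_boundedDensityClass (isClosed_boundedDensityClass hR)
    (fun φ hφ => norm_le_of_mem_boundedDensityClass hR hφ)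
    (convexOn_convexPart hD hac hab hV hconv) (isClosed_convexPart_le hD hac hab hV hR)
    (fun u v hu hv hlim => ?_) fun φ hφ => ?_
  · exact (tendsto_integral_mul_potential hR
      (fun n => mem_Icc_of_mem_boundedDensityClass (hu n))
      (mem_Icc_of_mem_boundedDensityClass hv) hlim).const_mul _
  · have h1 := norm_integral_le_of_norm_le_const (norm_convexPart_integrand_le hD hab hV hφ)
    have h2 : ‖∫ x in D, φ x * ∫ y in D, φ y / ‖x - y‖‖ ≤
        R * C * (volume.restrict D).real univ := by
      refine norm_integral_le_of_norm_le_const ?_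
      have hφ' := mem_Icc_of_mem_boundedDensityClass hφ
      filter_upwards [hφ'] with x hx
      rw [norm_mul, Real.norm_of_nonneg hx.1]
      exact mul_le_mul hx.2 (abs_potential_le hR hφ' x) (norm_nonneg _) hR
    have h3 := (abs_le.1 h1).1
    have h4 := (abs_le.1 h2).2
    linarith

end ConvexPart

theorem norm_rot (θ : ℝ) (x : R3) : ‖rot θ x‖ = ‖x‖ := by
  rw [EuclideanSpace.norm_eq, EuclideanSpace.norm_eq]
  congr 1
  simp only [Fin.sum_univ_three, Real.norm_eq_abs, sq_abs]
  simp [rot]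
  linear_combination (x 0 ^ 2 + x 1 ^ 2) * Real.sin_sq_add_cos_sq θ

theorem rot_neg_rot (θ : ℝ) (x : R3) : rot (-θ) (rot θ x) = x := by
  ext i
  fin_cases i
  · simp [rot]
    linear_combination x 0 * Real.sin_sq_add_cos_sq θ
  · simp [rot]
    linear_combination x 1 * Real.sin_sq_add_cos_sq θ
  · simp [rot]

theorem AxisymmetricSet.rot_mem_iff {K : Set R3} (hK : AxisymmetricSet K) (θ : ℝ) (x : R3) :
    rot θ x ∈ K ↔ x ∈ K :=
  ⟨fun h => by simpa only [rot_neg_rot] using hK (-θ) _ h, hK θ x⟩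

theorem AxisymmetricSet.rot_mem_closedBall_diff_iff {K : Set R3} (hK : AxisymmetricSet K)
    (R θ : ℝ) (x : R3) :
    rot θ x ∈ Metric.closedBall 0 R \ K ↔ x ∈ Metric.closedBall 0 R \ K := by
  simp only [Set.mem_sdiff, mem_closedBall_zero_iff, norm_rot, hK.rot_mem_iff]

theorem AxisymmetricFun.indicator_closedBall_diff {K : Set R3} (hK : AxisymmetricSet K) {R : ℝ}
    {g : R3 → ℝ} (hg : AxisymmetricFun g) :
    AxisymmetricFun ((Metric.closedBall 0 R \ K).indicator g) := by
  intro θ x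
  by_cases hx : x ∈ Metric.closedBall 0 R \ K
  · rw [indicator_of_mem hx, indicator_of_mem ((hK.rot_mem_closedBall_diff_iff R θ x).2 hx), hg]
  · rw [indicator_of_notMem hx,
      indicator_of_notMem fun h => hx ((hK.rot_mem_closedBall_diff_iff R θ x).1 h)]

section Truncation

variable {K : Set R3} {R : ℝ}

instance isFiniteMeasure_restrict_closedBall_diff :
    IsFiniteMeasure (volume.restrict (Metric.closedBall (0 : R3) R \ K)) :=
  ⟨by
    rw [Measure.restrict_apply_univ]
    exact (measure_mono sdiff_subset).trans_lt measure_closedBall_lt_top⟩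

theorem setIntegral_compl_eq_closedBall_diff (hK : IsOpen K) {g : R3 → ℝ}
    (hg : ∀ x ∉ Metric.closedBall (0 : R3) R, g x = 0) :
    ∫ x in Kᶜ, g x = ∫ x in Metric.closedBall 0 R \ K, g x :=
  setIntegral_eq_of_subset_of_forall_sdiff_eq_zero hK.measurableSet.compl (fun _ hx => hx.2)
    fun x hx => hg x fun h => hx.2 ⟨h, hx.1⟩

theorem Bpot_eq_of_ae_eq (hK : IsOpen K) {σ φ : R3 → ℝ}
    (hσ : ∀ x ∉ Metric.closedBall (0 : R3) R, σ x = 0)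
    (hφ : φ =ᵐ[volume.restrict (Metric.closedBall 0 R \ K)] σ) (x : R3) :
    Bpot K σ x = ∫ y in Metric.closedBall 0 R \ K, φ y / ‖x - y‖ := by
  rw [Bpot, setIntegral_compl_eq_closedBall_diff hK fun y hy => by rw [hσ y hy, zero_div]]
  refine integral_congr_ae ?_
  filter_upwards [hφ] with y hy
  rw [hy]

theorem Energy_eq_of_ae_eq (hK : IsOpen K) (hR : 0 ≤ R) {f : ℝ → ℝ} {J Φ : R3 → ℝ} {M : ℝ}
    {CA CV : ℝ} (hac : ContinuousOn (Afun f) (Ici 0)) (hab : ∀ s ∈ Icc 0 R, |Afun f s| ≤ CA)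
    (hV : ∀ x ∈ Metric.closedBall (0 : R3) R \ K, |J x + Φ x| ≤ CV) {σ : R3 → ℝ}
    (hσ : ∀ x ∉ Metric.closedBall (0 : R3) R, σ x = 0)
    {φ : Lp ℝ 2 (volume.restrict (Metric.closedBall (0 : R3) R \ K))}
    (hφS : φ ∈ boundedDensityClass (Metric.closedBall 0 R \ K) (fun x => J x + Φ x) M R)
    (hφ : φ =ᵐ[volume.restrict (Metric.closedBall 0 R \ K)] σ) :
    Energy K f J Φ σ =
      (∫ x in Metric.closedBall 0 R \ K, (Afun f (φ x) - φ x * (J x + Φ x))) -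
        1 / 2 * (∫ x in Metric.closedBall 0 R \ K,
          φ x * ∫ y in Metric.closedBall 0 R \ K, φ y / ‖x - y‖) := by
  have hD : MeasurableSet (Metric.closedBall (0 : R3) R \ K) :=
    Metric.isClosed_closedBall.measurableSet.diff hK.measurableSet
  have hmem := mem_Icc_of_mem_boundedDensityClass hφS
  have hQ : Integrable (fun x => φ x * ∫ y in Metric.closedBall 0 R \ K, φ y / ‖x - y‖)
      (volume.restrict (Metric.closedBall 0 R \ K)) := by
    refine Integrable.of_bound ((Lp.stronglyMeasurable φ).mul
      (stronglyMeasurable_potential (Lp.stronglyMeasurable φ))).aestronglyMeasurable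
      (R * (R * ((∫ z, singularPart z) +
        volume.real (Metric.closedBall (0 : R3) R \ K)))) ?_
    filter_upwards [hmem] with x hx
    rw [norm_mul, Real.norm_of_nonneg hx.1]
    exact mul_le_mul hx.2 (abs_potential_le hR hmem x) (norm_nonneg _) hR
  rw [Energy, setIntegral_compl_eq_closedBall_diff (R := R) hK fun x hx => by
      rw [hσ x hx, Afun_zero]; ring,
    ← integral_const_mul, ← integral_sub (integrable_convexPart hD hac hab hV hφS)
      (hQ.const_mul _)]
  refine integral_congr_ae ?_
  filter_upwards [hφ] with x hx
  rw [Bpot_eq_of_ae_eq hK hσ hφ, ← hx]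
  ring

theorem IsBoundedDensity.mem_WR (hK : IsOpen K) {f : ℝ → ℝ} {V : R3 → ℝ} {M CA : ℝ}
    (hac : ContinuousOn (Afun f) (Ici 0)) (hab : ∀ s ∈ Icc 0 R, |Afun f s| ≤ CA)
    {ρ : R3 → ℝ} (hρ : IsBoundedDensity (Metric.closedBall 0 R \ K) V M R ρ) :
    ρ ∈ WR K f M R := by
  have hzero : ∀ x ∉ Metric.closedBall (0 : R3) R, ρ x = 0 :=
    fun x hx => hρ.eq_zero x fun h => hx h.1
  refine ⟨⟨hρ.axisymmetric, Eventually.of_forall fun x => (hρ.mem_Icc x).1, ?_, ?_⟩, ?_,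
    Eventually.of_forall fun x => hρ.mem_Icc x⟩
  · have hint : IntegrableOn (fun x => Afun f (ρ x)) (Metric.closedBall 0 R \ K) :=
      Integrable.of_bound (aestronglyMeasurable_comp_of_continuousOn hac hρ.aestronglyMeasurable
        (Eventually.of_forall fun x => (hρ.mem_Icc x).1)) CA
        (Eventually.of_forall fun x => hab _ (hρ.mem_Icc x))
    refine hint.of_forall_sdiff_eq_zero hK.measurableSet.compl fun x hx => ?_
    rw [hρ.eq_zero x hx.2, Afun_zero]
  · rw [setIntegral_compl_eq_closedBall_diff hK hzero, hρ.mass]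
  · refine closure_minimal (fun x hx => ?_) Metric.isClosed_closedBall
    by_contra h
    exact hx (hzero x h)

theorem eq_zero_of_mem_WR {f : ℝ → ℝ} {M : ℝ} {σ : R3 → ℝ} (hσ : σ ∈ WR K f M R) {x : R3}
    (hx : x ∉ Metric.closedBall (0 : R3) R) : σ x = 0 :=
  image_eq_zero_of_notMem_tsupport fun h => hx (hσ.2.1 h)

theorem integrableOn_of_mem_WR {f : ℝ → ℝ} {M : ℝ} (hM : 0 < M) {σ : R3 → ℝ}
    (hσ : σ ∈ WR K f M R) : IntegrableOn σ Kᶜ := by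
  by_contra h
  have := hσ.1.2.2.2
  rw [integral_undef h] at this
  exact hM.ne this

theorem exists_ae_eq_of_mem_WR (hK : IsOpen K) (hKa : AxisymmetricSet K) (hR : 0 ≤ R) {f : ℝ → ℝ}
    {V : R3 → ℝ} {M : ℝ} (hM : 0 < M) {σ : R3 → ℝ} (hσ : σ ∈ WR K f M R)
    (hσV : AEStronglyMeasurable (fun x => σ x * V x)
      (volume.restrict (Metric.closedBall 0 R \ K))) :
    ∃ φ ∈ boundedDensityClass (Metric.closedBall 0 R \ K) V M R,
      φ =ᵐ[volume.restrict (Metric.closedBall 0 R \ K)] σ := by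
  set D := Metric.closedBall (0 : R3) R \ K
  have hD : MeasurableSet D := Metric.isClosed_closedBall.measurableSet.diff hK.measurableSet
  have hσm : AEStronglyMeasurable σ (volume.restrict D) :=
    ((integrableOn_of_mem_WR hM hσ).mono_set fun _ hx => hx.2).aestronglyMeasurable
  set ρ : R3 → ℝ := D.indicator fun x => max 0 (min (σ x) R) with hρ
  have hρσ : ρ =ᵐ[volume.restrict D] σ := by
    filter_upwards [ae_restrict_mem hD, ae_restrict_of_ae hσ.2.2] with x hxD hx
    rw [hρ, indicator_of_mem hxD, min_eq_left hx.2, max_eq_right hx.1]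
  have hρI : ∀ x, ρ x ∈ Icc 0 R := by
    intro x
    by_cases hx : x ∈ D
    · rw [hρ, indicator_of_mem hx]
      exact ⟨le_max_left _ _, max_le hR (min_le_right _ _)⟩
    · rw [hρ, indicator_of_notMem hx]
      exact ⟨le_rfl, hR⟩
  have hρm : AEStronglyMeasurable ρ (volume.restrict D) := hσm.congr hρσ.symm
  have hρL : MemLp ρ 2 (volume.restrict D) := by
    refine MemLp.of_bound hρm R (Eventually.of_forall fun x => ?_)
    rw [Real.norm_of_nonneg (hρI x).1]
    exact (hρI x).2
  refine ⟨hρL.toLp ρ, ⟨ρ, ⟨?_, hρI, fun x hx => indicator_of_notMem hx _, hρm, ?_, ?_⟩,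
    hρL.coeFn_toLp⟩, hρL.coeFn_toLp.trans hρσ⟩
  · refine AxisymmetricFun.indicator_closedBall_diff hKa fun θ x => ?_
    rw [hσ.1.1 θ x]
  · refine hσV.congr ?_
    filter_upwards [hρσ] with x hx
    rw [hx]
  · rw [integral_congr_ae hρσ, ← setIntegral_compl_eq_closedBall_diff hK
      fun x hx => eq_zero_of_mem_WR hσ hx]
    exact hσ.1.2.2.2

/-- The Bochner integral defining the energy takes the value `0` on densities for which the
rotational energy density is not measurable. -/
theorem Energy_eq_zero_of_not_aestronglyMeasurable (hK : IsOpen K) {f : ℝ → ℝ} {J Φ : R3 → ℝ}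
    {M : ℝ} (hM : 0 < M) (hac : ContinuousOn (Afun f) (Ici 0)) {σ : R3 → ℝ}
    (hσ : σ ∈ WR K f M R)
    (hσV : ¬ AEStronglyMeasurable (fun x => σ x * (J x + Φ x))
      (volume.restrict (Metric.closedBall 0 R \ K))) :
    Energy K f J Φ σ = 0 := by
  refine integral_undef fun hint => hσV ?_
  have hsub : Metric.closedBall (0 : R3) R \ K ⊆ Kᶜ := fun _ hx => hx.2
  have hm := (IntegrableOn.mono_set hint hsub).aestronglyMeasurable
  have hσm : AEStronglyMeasurable σ (volume.restrict (Metric.closedBall (0 : R3) R \ K)) :=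
    ((integrableOn_of_mem_WR hM hσ).mono_set hsub).aestronglyMeasurable
  have hA := aestronglyMeasurable_comp_of_continuousOn hac hσm
    (ae_restrict_of_ae (hσ.2.2.mono fun x hx => hx.1))
  have hB : StronglyMeasurable (Bpot K σ) := by
    rw [show Bpot K σ = _ from funext (Bpot_eq_of_ae_eq hK
      (fun x hx => eq_zero_of_mem_WR hσ hx) hσm.ae_eq_mk.symm)]
    exact stronglyMeasurable_potential hσm.stronglyMeasurable_mk
  refine ((hA.sub ((hσm.mul hB.aestronglyMeasurable).const_mul (1 / 2))).sub hm).congr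
    (Eventually.of_forall fun x => ?_)
  simp only [Pi.sub_apply, Pi.mul_apply]
  ring

theorem one_le_volume_closedBall_diff {r : ℝ} (hr : 0 < r) (hKr : K ⊆ Metric.ball 0 r)
    (hrR : r + 1 ≤ R) : 1 ≤ volume.real (Metric.closedBall (0 : R3) R \ K) := by
  have hvol : ∀ t : ℝ, 0 ≤ t →
      volume.real (Metric.closedBall (0 : R3) t) = t ^ 3 * (Real.pi * 4 / 3) := by
    intro t ht
    have hpi : 0 ≤ Real.pi * 4 / 3 := by positivity
    rw [measureReal_def, EuclideanSpace.volume_closedBall_fin_three, ENNReal.toReal_mul,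
      ENNReal.toReal_pow, ENNReal.toReal_ofReal ht, ENNReal.toReal_ofReal hpi]
  have hsub : Metric.closedBall (0 : R3) R ⊆
      (Metric.closedBall 0 R \ K) ∪ Metric.closedBall 0 r := by
    intro x hx
    by_cases h : x ∈ K
    · exact Or.inr (Metric.ball_subset_closedBall (hKr h))
    · exact Or.inl ⟨hx, h⟩
  have hfin : volume ((Metric.closedBall (0 : R3) R \ K) ∪ Metric.closedBall 0 r) ≠ ⊤ :=
    ((measure_mono (union_subset_union_left _ sdiff_subset)).trans_lt
      ((measure_union_le _ _).trans_lt (ENNReal.add_lt_top.2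
        ⟨measure_closedBall_lt_top, measure_closedBall_lt_top⟩))).ne
  have h := (measureReal_mono hsub hfin).trans (measureReal_union_le _ _)
  rw [hvol R (by linarith), hvol r hr.le] at h
  have hcube : 1 ≤ R ^ 3 - r ^ 3 := by
    have : (r + 1) ^ 3 ≤ R ^ 3 := by gcongr
    nlinarith [sq_nonneg r]
  have hpi : 1 ≤ Real.pi * 4 / 3 := by linarith [Real.pi_gt_three]
  nlinarith

theorem isBoundedDensity_uniform (hK : IsOpen K) (hKa : AxisymmetricSet K) {M : ℝ} (hM : 0 < M)
    (hMR : M ≤ R) (hvol : 1 ≤ volume.real (Metric.closedBall (0 : R3) R \ K)) :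
    IsBoundedDensity (Metric.closedBall 0 R \ K) 0 M R
      ((Metric.closedBall 0 R \ K).indicator fun _ =>
        M / volume.real (Metric.closedBall (0 : R3) R \ K)) := by
  have hD : MeasurableSet (Metric.closedBall (0 : R3) R \ K) :=
    Metric.isClosed_closedBall.measurableSet.diff hK.measurableSet
  refine ⟨AxisymmetricFun.indicator_closedBall_diff hKa fun _ _ => rfl, fun x => ?_,
    fun x hx => indicator_of_notMem hx _, ?_, ?_, ?_⟩
  · by_cases hx : x ∈ Metric.closedBall 0 R \ K
    · rw [indicator_of_mem hx]
      exact ⟨by positivity, (div_le_self hM.le hvol).trans hMR⟩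
    · rw [indicator_of_notMem hx]
      exact ⟨le_rfl, hM.le.trans hMR⟩
  · exact (stronglyMeasurable_const.indicator hD).aestronglyMeasurable
  · simpa using aestronglyMeasurable_const
  · rw [setIntegral_indicator hD, inter_self, setIntegral_const, smul_eq_mul]
    exact mul_div_cancel₀ _ (by linarith)

end Truncation

/-- **Proposition 4.2.** For all sufficiently large `R` the energy `E` attains its
infimum over the truncated admissible set `W_R`. -/
theorem minimizer_exists_on_WR
    (M : ℝ) (hM : 0 < M)
    (K : Set R3) (hKo : IsOpen K) (hKb : Bornology.IsBounded K) (hKa : AxisymmetricSet K)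
    (Φ : R3 → ℝ) (hΦ : PhiCond Φ)
    (f : ℝ → ℝ) (hf1 : F1 f) (hf2 : F2 f)
    (J : R3 → ℝ) (hJ0 : ∀ x, 0 ≤ J x) (hJb : ∃ CJ : ℝ, ∀ x, J x ≤ CJ)
    (hJa : AxisymmetricFun J) :
    ∃ R₀ > 0, K ⊆ Metric.ball 0 R₀ ∧
      ∀ R : ℝ, R > R₀ →
        ∃ ρR ∈ WR K f M R, ∀ σ ∈ WR K f M R,
          Energy K f J Φ ρR ≤ Energy K f J Φ σ := by

  obtain ⟨r, hr, hKr⟩ := hKb.subset_ball_lt 0 0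
  obtain ⟨CJ, hCJ⟩ := hJb
  refine ⟨r + 1 + M, by linarith, hKr.trans (Metric.ball_subset_ball (by linarith)),
    fun R hRR => ?_⟩
  have hR : 0 ≤ R := by linarith
  have hac := continuousOn_Afun hf1 hf2
  obtain ⟨CA, hCA⟩ := isCompact_Icc.exists_bound_of_continuousOn
    (hac.mono (Icc_subset_Ici_self : Icc 0 R ⊆ Ici 0))
  obtain ⟨CΦ, hCΦ⟩ := (isCompact_closedBall (0 : R3) R).exists_bound_of_continuousOn
    hΦ.1.continuous.continuousOn
  have hV : ∀ x ∈ Metric.closedBall (0 : R3) R \ K, |J x + Φ x| ≤ CJ + CΦ := fun x hx =>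
    (abs_add_le _ _).trans (add_le_add ((abs_of_nonneg (hJ0 x)).trans_le (hCJ x)) (hCΦ x hx.1))
  have hD : MeasurableSet (Metric.closedBall (0 : R3) R \ K) :=
    Metric.isClosed_closedBall.measurableSet.diff hKo.measurableSet
  have hW := (isBoundedDensity_uniform hKo hKa hM (by linarith)
    (one_le_volume_closedBall_diff hr hKr (by linarith))).mem_WR hKo (f := f) hac hCA
  set S := boundedDensityClass (Metric.closedBall 0 R \ K) (fun x => J x + Φ x) M R
  have hdich : ∀ σ ∈ WR K f M R, Energy K f J Φ σ = 0 ∨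
      ∃ φ ∈ S, φ =ᵐ[volume.restrict (Metric.closedBall 0 R \ K)] σ := by
    intro σ hσ
    by_cases hm : AEStronglyMeasurable (fun x => σ x * (J x + Φ x))
        (volume.restrict (Metric.closedBall 0 R \ K))
    · exact Or.inr (exists_ae_eq_of_mem_WR hKo hKa hR hM hσ hm)
    · exact Or.inl (Energy_eq_zero_of_not_aestronglyMeasurable hKo hM hac hσ hm)
  rcases S.eq_empty_or_nonempty with hemp | hne
  · have hzero : ∀ σ ∈ WR K f M R, Energy K f J Φ σ = 0 := fun σ hσ =>
      (hdich σ hσ).resolve_right fun ⟨φ, hφ, _⟩ => by simp [hemp] at hφ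
    exact ⟨_, hW, fun σ hσ => by rw [hzero _ hW, hzero σ hσ]⟩
  obtain ⟨φ, hφ, hmin⟩ := exists_min_energy_boundedDensityClass hD hac hCA hV
    (convexOn_Afun hf1 hf2) hR hne
  obtain ⟨ρ, hρ, hφρ⟩ := id hφ
  have hρW : ρ ∈ WR K f M R := hρ.mem_WR hKo hac hCA
  have hρmin : ∀ σ ∈ WR K f M R,
      (∃ ψ ∈ S, ψ =ᵐ[volume.restrict (Metric.closedBall 0 R \ K)] σ) →
      Energy K f J Φ ρ ≤ Energy K f J Φ σ := by
    rintro σ hσ ⟨ψ, hψ, hψσ⟩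
    rw [Energy_eq_of_ae_eq hKo hR hac hCA hV (fun x hx => eq_zero_of_mem_WR hρW hx) hφ hφρ,
      Energy_eq_of_ae_eq hKo hR hac hCA hV (fun x hx => eq_zero_of_mem_WR hσ hx) hψ hψσ]
    exact hmin ψ hψ
  by_cases hall : ∀ σ ∈ WR K f M R, Energy K f J Φ ρ ≤ Energy K f J Φ σ
  · exact ⟨ρ, hρW, hall⟩
  push Not at hall
  obtain ⟨τ, hτ, hτρ⟩ := hall
  have hτ0 : Energy K f J Φ τ = 0 :=
    (hdich τ hτ).resolve_right fun h => absurd (hρmin τ hτ h) (not_le.2 hτρ)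
  refine ⟨τ, hτ, fun σ hσ => ?_⟩
  rcases hdich σ hσ with h0 | hex
  · rw [hτ0, h0]
  · exact hτρ.le.trans (hρmin σ hσ hex)
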